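/- Let f(τ) = η(τ)⁴/η(2τ)⁸ on the upper half-plane ℍ. Then for every matrix M = ((a,b),(c,d)) ∈ Γ₁(2) and every τ ∈ ℍ one has f((aτ+b)/(cτ+d)) = e(−b/2)·(cτ+d)^{−2}·f(τ), i.e. f is a (weakly holomorphic) modular form of weight −2 for Γ₁(2) with character χ(M) = e(−b/2). -/

import Mathlib

open Complex UpperHalfPlane CongruenceSubgroup
open scoped MatrixGroups

noncomputable section

/-- `e(z) = exp(2πiz)`. -/
def eFun (z : ℂ) : ℂ := Complex.exp (2 * Real.pi * Complex.I * z)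

/-- The Dedekind eta function `η(τ) = e(τ/24) ∏_{n=1}^∞ (1 - e(nτ))`. -/
def DedekindEta (z : ℂ) : ℂ :=
  eFun (z / 24) * ∏' n : ℕ, (1 - eFun ((n + 1) * z))

section

open scoped ModularForm

lemma eFun_add (x y : ℂ) : eFun (x + y) = eFun x * eFun y := by
  simp only [eFun, mul_add, Complex.exp_add]

lemma eFun_intCast (n : ℤ) : eFun n = 1 := by
  rw [eFun, mul_comm]
  exact Complex.exp_int_mul_two_pi_mul_I n

lemma eFun_zero : eFun 0 = 1 := by
  simp [eFun]

lemma eFun_add_intCast (x : ℂ) (n : ℤ) : eFun (x + n) = eFun x := by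
  rw [eFun_add, eFun_intCast, mul_one]

lemma eFun_pow (x : ℂ) (n : ℕ) : eFun x ^ n = eFun (n * x) := by
  rw [eFun, eFun, ← Complex.exp_nat_mul]
  ring_nf

lemma dedekindEta_eq_eta (z : ℂ) : DedekindEta z = ModularForm.eta z := by
  simp only [DedekindEta, ModularForm.eta, ModularForm.eta_q_eq_cexp, eFun,
    Function.Periodic.qParam]
  push_cast
  ring_nf

lemma dedekindEta_add_one (z : ℂ) : DedekindEta (z + 1) = eFun (1 / 24) * DedekindEta z := by
  have h (n : ℕ) : eFun ((n + 1) * (z + 1)) = eFun ((n + 1) * z) := by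
    rw [← eFun_add_intCast ((n + 1) * z) (n + 1)]
    push_cast
    ring_nf
  simp only [DedekindEta, h, add_div, eFun_add]
  ring

lemma sqrt_pow_four {z : ℂ} (hz : z ≠ 0) : sqrt z ^ 4 = z ^ 2 := by
  rw [sqrt_eq_exp hz, ← exp_nat_mul]
  conv_rhs => rw [← exp_log hz, ← exp_nat_mul]
  ring_nf

lemma dedekindEta_neg_one_div_pow_four {z : ℂ} (hz : 0 < z.im) :
    DedekindEta (-1 / z) ^ 4 = -z ^ 2 * DedekindEta z ^ 4 := by
  have hz0 : z ≠ 0 := by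
    rintro rfl
    simp at hz
  have h := ModularForm.eta_comp_eq_csqrt_I_inv (show z ∈ upperHalfPlaneSet from hz)
  simp only [Function.comp_apply, Pi.smul_apply, Pi.mul_apply, smul_eq_mul] at h
  rw [dedekindEta_eq_eta, dedekindEta_eq_eta, h, mul_pow, mul_pow, inv_pow,
    sqrt_pow_four I_ne_zero, sqrt_pow_four hz0, I_sq]
  ring

/-- The eta quotient `η(τ)⁴/η(2τ)⁸` as a function on the upper half-plane. -/
def etaQuotient (τ : ℍ) : ℂ := DedekindEta τ ^ 4 / DedekindEta (2 * τ) ^ 8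

lemma etaQuotient_slash_S (τ : ℍ) : (etaQuotient ∣[(-2 : ℤ)] ModularGroup.S) τ =
    -16 * (DedekindEta τ ^ 4 / DedekindEta (τ / 2) ^ 8) := by
  have h2 : (2 : ℂ) * (-1 / τ) = -1 / (τ / 2) := by
    field_simp
  have hτ := τ.ne_zero
  have him : 0 < ((τ : ℂ) / 2).im := by
    simpa using τ.im_pos
  have h8 : DedekindEta (-1 / (τ / 2)) ^ 8 = (τ / 2) ^ 4 * DedekindEta (τ / 2) ^ 8 := by
    rw [show 8 = 4 * 2 from rfl, pow_mul, dedekindEta_neg_one_div_pow_four him]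
    ring
  have hS : etaQuotient (ModularGroup.S • τ) =
      DedekindEta (-1 / τ) ^ 4 / DedekindEta (2 * (-1 / τ)) ^ 8 := by
    rw [etaQuotient, modular_S_smul]
    simp [neg_div]
  rw [ModularForm.SL_slash_apply, hS, ModularGroup.denom_S, h2, h8,
    dedekindEta_neg_one_div_pow_four τ.im_pos]
  have : DedekindEta (τ / 2) ≠ 0 := by
    rw [dedekindEta_eq_eta]
    exact ModularForm.eta_ne_zero him
  field_simp
  norm_num
  ring

lemma T_zpow_slash_apply (f : ℍ → ℂ) (k n : ℤ) (τ : ℍ) :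
    (f ∣[k] (ModularGroup.T ^ n)) τ = f (ModularGroup.T ^ n • τ) := by
  rw [ModularForm.SL_slash_apply, denom]
  simp [ModularGroup.coe_T_zpow, -map_zpow]

lemma etaQuotient_slash_T :
    etaQuotient ∣[(-2 : ℤ)] ModularGroup.T = eFun (-1 / 2) • etaQuotient := by
  ext τ
  have h2 : (2 : ℂ) * (τ + 1) = 2 * τ + 1 + 1 := by ring
  have he : eFun (1 / 24) ^ 4 = (eFun (1 / 24) * eFun (1 / 24)) ^ 8 * eFun (-1 / 2) := by
    simp only [← eFun_add, eFun_pow]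
    norm_num
  have hne : eFun (1 / 24) ≠ 0 := Complex.exp_ne_zero _
  rw [← zpow_one ModularGroup.T, T_zpow_slash_apply, etaQuotient,
    ModularGroup.coe_T_zpow_smul_eq, Int.cast_one, h2]
  simp only [dedekindEta_add_one, etaQuotient, Pi.smul_apply, smul_eq_mul]
  rw [← mul_assoc (eFun _), mul_pow, he, mul_assoc, mul_pow (_ * _),
    mul_div_mul_left _ _ (pow_ne_zero _ (mul_ne_zero hne hne)), mul_div_assoc]

lemma etaQuotient_slash_S_slash_T_sq :
    (etaQuotient ∣[(-2 : ℤ)] ModularGroup.S) ∣[(-2 : ℤ)] (ModularGroup.T ^ (2 : ℤ)) =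
      etaQuotient ∣[(-2 : ℤ)] ModularGroup.S := by
  ext τ
  have h2 : ((τ : ℂ) + 2) / 2 = τ / 2 + 1 := by ring
  have h1 : (τ : ℂ) + 2 = τ + 1 + 1 := by ring
  have he : (eFun (1 / 24) * eFun (1 / 24)) ^ 4 = eFun (1 / 24) ^ 8 := by ring
  have hne : eFun (1 / 24) ≠ 0 := Complex.exp_ne_zero _
  rw [T_zpow_slash_apply, etaQuotient_slash_S, etaQuotient_slash_S, ModularGroup.coe_T_zpow_smul_eq,
    Int.cast_ofNat, h2, h1]
  simp only [dedekindEta_add_one]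
  rw [← mul_assoc, mul_pow (_ * _), mul_pow _ _ 8, he, mul_div_mul_left _ _ (pow_ne_zero _ hne)]

/-- The matrices in `Γ₁(2)` under which `η(τ)⁴/η(2τ)⁸` transforms in weight `-2` by the character
`e(-b/2)`. -/
def etaQuotientStabilizer : Subgroup SL(2, ℤ) where
  carrier := {M | M ∈ Gamma1 2 ∧
    etaQuotient ∣[(-2 : ℤ)] M = eFun (-(M 0 1 : ℂ) / 2) • etaQuotient}
  one_mem' := ⟨one_mem _, by
    simp [eFun_zero]⟩
  mul_mem' := by
    rintro A B ⟨hA, hfA⟩ ⟨hB, hfB⟩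
    refine ⟨mul_mem hA hB, ?_⟩
    rw [SlashAction.slash_mul, hfA, ModularForm.SL_smul_slash, hfB, smul_smul, ← eFun_add]
    congr 1
    rw [Gamma1_mem] at hA hB
    obtain ⟨r, hr⟩ := (ZMod.intCast_eq_intCast_iff_dvd_sub 1 (A 0 0) 2).1 (by simp [hA.1])
    obtain ⟨s, hs⟩ := (ZMod.intCast_eq_intCast_iff_dvd_sub 1 (B 1 1) 2).1 (by simp [hB.2.1])
    rw [← eFun_add_intCast _ (-(r * B 0 1 + A 0 1 * s))]
    congr 1
    have hAB : (A * B) 0 1 = A 0 0 * B 0 1 + A 0 1 * B 1 1 := by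
      simp [Matrix.mul_apply, Fin.sum_univ_two]
    rw [hAB, sub_eq_iff_eq_add.1 hr, sub_eq_iff_eq_add.1 hs]
    push_cast
    ring
  inv_mem' := by
    rintro A ⟨hA, hfA⟩
    refine ⟨inv_mem hA, ?_⟩
    have h : etaQuotient = eFun (-(A 0 1 : ℂ) / 2) • (etaQuotient ∣[(-2 : ℤ)] A⁻¹) := by
      rw [← ModularForm.SL_smul_slash, ← hfA, ← SlashAction.slash_mul, mul_inv_cancel,
        SlashAction.slash_one]
    nth_rw 2 [h]
    rw [smul_smul, ← eFun_add]
    simp [Matrix.SpecialLinearGroup.SL2_inv_expl, ← add_div, eFun_zero]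

lemma T_mem_etaQuotientStabilizer : ModularGroup.T ∈ etaQuotientStabilizer := by
  refine ⟨?_, ?_⟩
  · simp [Gamma1_mem, ModularGroup.coe_T]
  · rw [etaQuotient_slash_T]
    simp [ModularGroup.coe_T]

lemma coe_S_mul_T_zpow_mul_S_inv (n : ℤ) :
    (ModularGroup.S * ModularGroup.T ^ n * ModularGroup.S⁻¹).1 = !![1, 0; -n, 1] := by
  rw [Matrix.SpecialLinearGroup.coe_mul, Matrix.SpecialLinearGroup.coe_mul,
    ModularGroup.coe_T_zpow, Matrix.SpecialLinearGroup.coe_inv, ModularGroup.coe_S]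
  simp [Matrix.adjugate_fin_two_of]

lemma S_mul_T_sq_mul_S_inv_mem_etaQuotientStabilizer :
    ModularGroup.S * ModularGroup.T ^ (2 : ℤ) * ModularGroup.S⁻¹ ∈ etaQuotientStabilizer := by
  refine ⟨?_, ?_⟩
  · rw [Gamma1_mem, coe_S_mul_T_zpow_mul_S_inv]
    decide
  · rw [SlashAction.slash_mul, SlashAction.slash_mul, etaQuotient_slash_S_slash_T_sq,
      ← SlashAction.slash_mul, mul_inv_cancel, SlashAction.slash_one, coe_S_mul_T_zpow_mul_S_inv]
    simp [eFun_zero]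

lemma neg_one_mem_etaQuotientStabilizer : (-1 : SL(2, ℤ)) ∈ etaQuotientStabilizer := by
  refine ⟨?_, ?_⟩
  · rw [Gamma1_mem]
    simp
  · ext τ
    rw [ModularForm.SL_slash_apply]
    simp [denom, eFun_zero]

lemma mem_etaQuotientStabilizer_of_lower_left_eq_zero {M : SL(2, ℤ)} (hc : M 1 0 = 0) :
    M ∈ etaQuotientStabilizer := by
  have hdet : M 0 0 * M 1 1 = 1 := by
    have := M.det_coe
    rwa [Matrix.det_fin_two, hc, mul_zero, sub_zero] at this
  rcases Int.mul_eq_one_iff_eq_one_or_neg_one.1 hdet with ⟨ha, hd⟩ | ⟨ha, hd⟩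
  · have hMT : M = ModularGroup.T ^ (M 0 1) := by
      ext i j
      rw [ModularGroup.coe_T_zpow]
      fin_cases i <;> fin_cases j <;> simp [ha, hc, hd]
    rw [hMT]
    exact zpow_mem T_mem_etaQuotientStabilizer _
  · have hMT : M = -1 * ModularGroup.T ^ (-M 0 1) := by
      ext i j
      rw [neg_one_mul, Matrix.SpecialLinearGroup.coe_neg, ModularGroup.coe_T_zpow]
      fin_cases i <;> fin_cases j <;> simp [ha, hc, hd]
    rw [hMT]
    exact mul_mem neg_one_mem_etaQuotientStabilizer (zpow_mem T_mem_etaQuotientStabilizer _)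

lemma exists_two_mul_abs_add_mul_le (d : ℤ) {c : ℤ} (hc : c ≠ 0) :
    ∃ n : ℤ, 2 * |d + n * c| ≤ |c| := by
  have hc' : (c : ℚ) ≠ 0 := Int.cast_ne_zero.2 hc
  refine ⟨-round (d / c : ℚ), ?_⟩
  have h := mul_le_mul_of_nonneg_right (abs_sub_round (d / c : ℚ)) (abs_nonneg (c : ℚ))
  rw [← abs_mul, sub_mul, div_mul_cancel₀ _ hc'] at h
  have : (2 * |(d : ℚ) + (-round (d / c : ℚ) : ℤ) * c| : ℚ) ≤ |(c : ℚ)| := by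
    push_cast
    rw [neg_mul, ← sub_eq_add_neg]
    linarith
  exact_mod_cast this

lemma Gamma1_two_le_etaQuotientStabilizer : Gamma1 2 ≤ etaQuotientStabilizer := by
  intro M hM
  induction h : (M 1 0).natAbs using Nat.strong_induction_on generalizing M with | _ N ih
  by_cases hc : M 1 0 = 0
  · exact mem_etaQuotientStabilizer_of_lower_left_eq_zero hc
  obtain ⟨n, hn⟩ := exists_two_mul_abs_add_mul_le (M 1 1) hc
  obtain ⟨-, hd, hc2⟩ := (Gamma1_mem _ _).1 hM
  have hd' : M 1 1 + n * M 1 0 ≠ 0 := by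
    intro h0
    have := congrArg (Int.cast : ℤ → ZMod 2) h0
    push_cast at this
    simp [hd, hc2] at this
  obtain ⟨m, hm⟩ := exists_two_mul_abs_add_mul_le (M 1 0) (mul_ne_zero two_ne_zero hd')
  have hT := zpow_mem T_mem_etaQuotientStabilizer n
  have hV := zpow_mem S_mul_T_sq_mul_S_inv_mem_etaQuotientStabilizer (-m)
  rw [conj_zpow, ← zpow_mul] at hV
  rw [← Subgroup.mul_mem_cancel_right _ hT, ← Subgroup.mul_mem_cancel_right _ hV]
  refine ih _ ?_ (mul_mem (mul_mem hM hT.1) hV.1) rfl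
  have hcM : (M * ModularGroup.T ^ n *
      (ModularGroup.S * ModularGroup.T ^ (2 * -m) * ModularGroup.S⁻¹)) 1 0 =
      M 1 0 + m * (2 * (M 1 1 + n * M 1 0)) := by
    rw [Matrix.SpecialLinearGroup.coe_mul, coe_S_mul_T_zpow_mul_S_inv,
      Matrix.SpecialLinearGroup.coe_mul, ModularGroup.coe_T_zpow]
    simp [Matrix.mul_apply, Fin.sum_univ_two]
    ring
  rw [hcM, ← h]
  rw [abs_mul, abs_two] at hm
  have := abs_pos.2 hc
  zify
  linarith

end

/-- `f(τ) = η(τ)⁴/η(2τ)⁸` is a weakly holomorphic modular form of weight `-2`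
for `Γ₁(2)` with character `χ(M) = e(-b/2)`. -/
theorem eta_quotient_level_two_modular (M : SL(2, ℤ)) (hM : M ∈ Gamma1 2) (τ : ℍ) :
    (fun z : ℂ => DedekindEta z ^ 4 / DedekindEta (2 * z) ^ 8)
        (((M.1 0 0 : ℂ) * τ + (M.1 0 1 : ℂ)) / ((M.1 1 0 : ℂ) * τ + (M.1 1 1 : ℂ)))
      = eFun (-(M.1 0 1 : ℂ) / 2) * ((M.1 1 0 : ℂ) * τ + (M.1 1 1 : ℂ)) ^ (-2 : ℤ) *
          (DedekindEta τ ^ 4 / DedekindEta (2 * τ) ^ 8) := by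
  have h := congrFun (Gamma1_two_le_etaQuotientStabilizer hM).2 τ
  rw [ModularForm.SL_slash_apply] at h
  have hd : denom M τ ≠ 0 := denom_ne_zero _ _
  rw [etaQuotient, coe_specialLinearGroup_apply] at h
  simp [denom, etaQuotient] at h hd ⊢
  rw [mul_right_comm, ← h, mul_inv_cancel_right₀ (pow_ne_zero _ hd)]
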